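/- (Theorem 5, second part: every free non-boundary voxel in a column containing a boundary voxel lies in a constructed tile.) Let occ : ℤ³ → S be an occupancy map and let q = (x, y, z) ∈ ℤ³ be a voxel that is not a boundary voxel and satisfies occ(q) = free. Assume that the vertical column of q contains at least one boundary voxel, i.e., there exists z' ∈ ℤ such that (x, y, z') is a boundary voxel. Then there exist ε ∈ {1, −1} and an integer r ≥ 1 such that (x, y, z + ε·r) is a boundary interior voxel and, for every integer i with 0 ≤ i < r, the voxel (x, y, z + ε·i) is not a boundary voxel; that is, the nearest boundary voxel to q along the z⁺ or the z⁻ direction exists and is a boundary interior voxel. -/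

import Mathlib

inductive OccState : Type
  | free | occupied | unknown
deriving DecidableEq

abbrev Voxel := ℤ × ℤ × ℤ

/-- Two voxels are 6-neighbors iff their ℓ¹ distance is 1. -/
def sixNbr (m n : Voxel) : Prop :=
  |m.1 - n.1| + |m.2.1 - n.2.1| + |m.2.2 - n.2.2| = 1

/-- Boundary interior voxel: free, with a 6-neighbor that is unknown or occupied. -/
def bdInt (occ : Voxel → OccState) (n : Voxel) : Prop :=
  occ n = OccState.free ∧
    ∃ m, sixNbr m n ∧ (occ m = OccState.unknown ∨ occ m = OccState.occupied)

/-- Boundary exterior (unknown) voxel: unknown, with a free 6-neighbor. -/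
def bdUkn (occ : Voxel → OccState) (n : Voxel) : Prop :=
  occ n = OccState.unknown ∧ ∃ m, sixNbr m n ∧ occ m = OccState.free

/-- Boundary exterior (occupied) voxel: any occupied voxel. -/
def bdOcc (occ : Voxel → OccState) (n : Voxel) : Prop :=
  occ n = OccState.occupied

/-- Boundary voxel. -/
def bdVoxel (occ : Voxel → OccState) (n : Voxel) : Prop :=
  bdInt occ n ∨ bdUkn occ n ∨ bdOcc occ n

/-- An axis direction: exactly one nonzero coordinate, equal to ±1 (ℓ¹ norm 1). -/
def axisDir (e : Voxel) : Prop :=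
  |e.1| + |e.2.1| + |e.2.2| = 1

/-- Every 6-neighbor of a free non-boundary voxel is free. -/
theorem free_of_sixNbr {occ : Voxel → OccState} {m n : Voxel} (hn : ¬ bdVoxel occ n)
    (hfree : occ n = OccState.free) (h : sixNbr m n) : occ m = OccState.free := by
  cases hm : occ m with
  | free => rfl
  | occupied => exact absurd (Or.inl ⟨hfree, m, h, Or.inr hm⟩) hn
  | unknown => exact absurd (Or.inl ⟨hfree, m, h, Or.inl hm⟩) hn

/-- Walking along a column from a free voxel through non-boundary voxels only meets free voxels. -/
theorem free_of_forall_lt_not_bdVoxel {occ : Voxel → OccState} {x y z ε : ℤ}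
    (hε : ε = 1 ∨ ε = -1) (hfree : occ (x, y, z) = OccState.free) (k : ℕ)
    (h : ∀ i < k, ¬ bdVoxel occ (x, y, z + ε * (i : ℤ))) :
    occ (x, y, z + ε * (k : ℤ)) = OccState.free := by
  induction k with
  | zero => simpa using hfree
  | succ k ih =>
    refine free_of_sixNbr (h k k.lt_succ_self) (ih fun i hi => h i (by omega)) ?_
    rcases hε with rfl | rfl <;> simp [sixNbr]

/-- A boundary voxel that is free is a boundary interior voxel. -/
theorem bdInt_of_bdVoxel_of_free {occ : Voxel → OccState} {n : Voxel} (h : bdVoxel occ n)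
    (hfree : occ n = OccState.free) : bdInt occ n := by
  simpa [bdVoxel, bdUkn, bdOcc, hfree] using h

theorem stmt8 (occ : Voxel → OccState) (x y z : ℤ)
    (hq : ¬ bdVoxel occ (x, y, z)) (hfree : occ (x, y, z) = OccState.free)
    (hcol : ∃ z' : ℤ, bdVoxel occ (x, y, z')) :
    ∃ ε : ℤ, (ε = 1 ∨ ε = -1) ∧ ∃ r : ℤ, 1 ≤ r ∧
      bdInt occ (x, y, z + ε * r) ∧
      ∀ i : ℤ, 0 ≤ i → i < r → ¬ bdVoxel occ (x, y, z + ε * i) := by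
  obtain ⟨z', hz'⟩ := hcol
  obtain ⟨ε, hε, hex⟩ : ∃ ε : ℤ, (ε = 1 ∨ ε = -1) ∧
      ∃ k : ℕ, bdVoxel occ (x, y, z + ε * (k : ℤ)) := by
    rcases le_total z z' with h | h
    · refine ⟨1, Or.inl rfl, (z' - z).toNat, ?_⟩
      rwa [show z + 1 * ((z' - z).toNat : ℤ) = z' by omega]
    · refine ⟨-1, Or.inr rfl, (z - z').toNat, ?_⟩
      rwa [show z + -1 * ((z - z').toNat : ℤ) = z' by omega]
  classical
  have hmin : ∀ i < Nat.find hex, ¬ bdVoxel occ (x, y, z + ε * (i : ℤ)) :=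
    fun i hi => Nat.find_min hex hi
  have hpos : Nat.find hex ≠ 0 := fun h0 => hq (by simpa [h0] using Nat.find_spec hex)
  refine ⟨ε, hε, Nat.find hex, by omega, bdInt_of_bdVoxel_of_free (Nat.find_spec hex)
    (free_of_forall_lt_not_bdVoxel hε hfree _ hmin), fun i hi hlt => ?_⟩
  lift i to ℕ using hi
  exact hmin i (by exact_mod_cast hlt)
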